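/- Main theorem: for every α > 0, the normalised equal area Wendland functions converge uniformly on [0, ∞) to the Gaussian: sup_{y ≥ 0} |ψ_{ℓ,k}(y) - e^{-αy²}| → 0 as k → ∞ (through integers and half-integers), with ℓ = ⌊d/2+k⌋+1. -/

import Mathlib

open Real Filter MeasureTheory

/-- The Wendland function φ_{ℓ,k}. -/
noncomputable def wendland (l : ℕ) (k : ℝ) (r : ℝ) : ℝ :=
  if r ≤ 1 then
    (1 / (Real.Gamma k * (2:ℝ) ^ (k - 1))) *
      ∫ s in r..1, s * (1 - s) ^ l * (s ^ 2 - r ^ 2) ^ (k - 1)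
  else 0

/-- ℓ = ⌊d/2 + k⌋ + 1. -/
noncomputable def lfun (d : ℕ) (k : ℝ) : ℕ := (⌊(d : ℝ) / 2 + k⌋ + 1).toNat

/-- The scaling factor δ_{ℓ,k}(α). -/
noncomputable def wendlandDelta (l : ℕ) (k α : ℝ) : ℝ :=
  ((l : ℝ) + 2 * k + 1) * Real.Gamma (k + 1/2) / (2 * Real.sqrt α * Real.Gamma (k + 1))

/-- The normalised equal area Wendland function ψ_{ℓ,k}. -/
noncomputable def psi (l : ℕ) (k α : ℝ) (y : ℝ) : ℝ :=
  if y ≤ wendlandDelta l k α then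
    (2:ℝ) ^ (k - 1) * Real.Gamma k * Real.Gamma ((l : ℝ) + 2 * k + 1) /
        (Real.Gamma ((l : ℝ) + 1) * Real.Gamma (2 * k)) *
      wendland l k (y / wendlandDelta l k α)
  else 0

open Set in
lemma wg_beta (a b : ℕ) : ∫ s in (0:ℝ)..1, s ^ a * (1 - s) ^ b
    = (a.factorial * b.factorial : ℝ) / (a + b + 1).factorial := by
  have h := Complex.betaIntegral_eq_Gamma_mul_div (a + 1 : ℂ) (b + 1 : ℂ)
    (by simp; positivity) (by simp; positivity)
  rw [Complex.Gamma_nat_eq_factorial, Complex.Gamma_nat_eq_factorial,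
    show (a + 1 + (b + 1) : ℂ) = ((a + b + 1 : ℕ) : ℂ) + 1 by push_cast; ring,
    Complex.Gamma_nat_eq_factorial, Complex.betaIntegral] at h
  simp only [add_sub_cancel_right, Complex.cpow_natCast] at h
  apply Complex.ofReal_injective
  rw [← intervalIntegral.integral_ofReal]
  push_cast
  exact h

lemma wg_exp_u (u : ℝ) : u * exp (-u) ≤ 1 := by
  have := Real.add_one_le_exp u
  rw [Real.exp_neg, ← div_eq_mul_inv, div_le_one (exp_pos _)]; linarith

/-- Difference of exponentials, a ≤ b. -/
lemma wg_exp_diff (a b : ℝ) : exp (-a) - exp (-b) ≤ (b - a) * exp (-a) := by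
  have h := Real.add_one_le_exp (a - b)
  have h2 : exp (-b) = exp (a - b) * exp (-a) := by rw [← Real.exp_add]; ring_nf
  rw [h2]; nlinarith [exp_pos (-a)]

lemma wg_lip (u x : ℝ) (hu : 0 ≤ u) (hx : 0 < x) :
    |exp (-(u / x ^ 2)) - exp (-u)| ≤ 6 * |x - 1| := by
  have hv : 0 ≤ u / x ^ 2 := by positivity
  have e1 : exp (-(u / x ^ 2)) ≤ 1 := by rw [Real.exp_le_one_iff]; linarith
  have e2 : exp (-u) ≤ 1 := by rw [Real.exp_le_one_iff]; linarith
  have p1 := exp_pos (-(u / x ^ 2))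
  have p2 := exp_pos (-u)
  have q1 := wg_exp_u u
  have q2 := wg_exp_u (u / x ^ 2)
  have hu' : u = (u / x ^ 2) * x ^ 2 := by field_simp
  rcases le_total x 1 with h | h
  · rw [abs_of_nonpos (by linarith : x - 1 ≤ 0)]
    have hle : u ≤ u / x ^ 2 := by
      rw [le_div_iff₀ (by positivity)]; nlinarith [mul_nonneg hu hx.le, mul_nonneg hu (sub_nonneg.2 h)]
    have hle' : exp (-(u / x ^ 2)) ≤ exp (-u) := Real.exp_le_exp.2 (by linarith)
    rw [abs_of_nonpos (by linarith)]
    rcases le_total x (1/2) with h2 | h2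
    · linarith
    · have := wg_exp_diff u (u / x ^ 2)
      have h3 : (u / x ^ 2 - u) ≤ u * (6 * (1 - x)) := by
        have : u / x ^ 2 - u = u * ((1 - x) * ((1 + x) / x ^ 2)) := by field_simp; ring
        rw [this]
        have h4 : (1 + x) / x ^ 2 ≤ 6 := by
          rw [div_le_iff₀ (by positivity)]; nlinarith
        have h5 : (1 - x) * ((1 + x) / x ^ 2) ≤ 6 * (1 - x) := by nlinarith
        gcongr
      nlinarith
  · rw [abs_of_nonneg (by linarith : 0 ≤ x - 1)]
    have hle : u / x ^ 2 ≤ u := by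
      apply div_le_self hu; nlinarith
    have hle' : exp (-u) ≤ exp (-(u / x ^ 2)) := Real.exp_le_exp.2 (by linarith)
    rw [abs_of_nonneg (by linarith)]
    rcases le_total x 2 with h2 | h2
    · have := wg_exp_diff (u / x ^ 2) u
      have h3 : u - u / x ^ 2 = (u / x ^ 2) * (x ^ 2 - 1) := by field_simp
      rw [h3, mul_right_comm] at this
      have h4 : u / x ^ 2 * exp (-(u / x ^ 2)) * (x ^ 2 - 1) ≤ 1 * (x ^ 2 - 1) := by
        apply mul_le_mul_of_nonneg_right q2; nlinarith
      nlinarith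
    · linarith

/-- The truncated power approximates the exponential. -/
lemma wg_pow (k u : ℝ) (hk : 2 ≤ k) (hu : 0 ≤ u) :
    |(max (1 - u / k) 0) ^ (k - 1) - exp (-u)| ≤ 2 / (k - 1) := by
  have hk0 : 0 < k := by linarith
  have hk1 : 0 < k - 1 := by linarith
  have hm0 : 0 ≤ max (1 - u / k) 0 := le_max_right _ _
  have hm1 : max (1 - u / k) 0 ≤ 1 := max_le (by have : 0 ≤ u / k := by positivity
                                                 linarith) zero_le_one
  have q1 := wg_exp_u u
  have hkk : 2 / k ≤ 2 / (k - 1) := by gcongr; linarith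
  rw [abs_le]
  constructor
  · -- lower bound
    rcases le_total u k with h | h
    · have hx : 0 ≤ 1 - u / k := by rw [sub_nonneg, div_le_one hk0]; exact h
      have hx1 : u / k ≤ 1 := by linarith
      have hx0 : 0 ≤ u / k := by positivity
      rw [max_eq_left hx] at hm1 ⊢
      have h1 : (1 - u / k) ^ k ≤ (1 - u / k) ^ (k - 1) :=
        Real.rpow_le_rpow_of_exponent_ge' hx hm1 hk1.le (by linarith)
      have h2 : 1 + k * (-(u / k) ^ 2) ≤ (1 + (-(u / k) ^ 2)) ^ k :=
        one_add_mul_self_le_rpow_one_add (by nlinarith) (by linarith)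
      have h3 : (1 + (-(u / k) ^ 2)) ^ k ≤ ((1 - u / k) * exp (u / k)) ^ k := by
        apply Real.rpow_le_rpow (by nlinarith) _ hk0.le
        have := Real.add_one_le_exp (u / k)
        nlinarith
      rw [Real.mul_rpow hx (exp_pos _).le, ← Real.exp_mul, div_mul_cancel₀ u hk0.ne'] at h3
      have h4 : 1 - u ^ 2 / k ≤ (1 - u / k) ^ k * exp u := by
        have : 1 + k * (-(u / k) ^ 2) = 1 - u ^ 2 / k := by field_simp; ring
        linarith
      have h5 : (1 - u ^ 2 / k) * exp (-u) ≤ (1 - u / k) ^ k := by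
        calc _ ≤ (1 - u / k) ^ k * exp u * exp (-u) := by gcongr
          _ = _ := by rw [mul_assoc, ← Real.exp_add]; simp
      have h6 : u ^ 2 * exp (-u) ≤ 2 := by
        have := Real.quadratic_le_exp_of_nonneg hu
        rw [Real.exp_neg, ← div_eq_mul_inv, div_le_iff₀ (exp_pos _)]; nlinarith
      have h7 : u ^ 2 / k * exp (-u) ≤ 2 / k := by
        rw [div_mul_eq_mul_div]; gcongr
      nlinarith
    · have h1 : exp (-u) ≤ 1 / k := by
        rw [le_div_iff₀ hk0]; nlinarith [exp_pos (-u)]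
      have h2 : 1 / k ≤ 2 / k := by gcongr; norm_num
      have := Real.rpow_nonneg hm0 (k - 1)
      linarith
  · have h1 : (max (1 - u / k) 0) ^ (k - 1) ≤ exp (-(u * (k - 1) / k)) := by
      calc _ ≤ (exp (-(u / k))) ^ (k - 1) := by
            apply Real.rpow_le_rpow hm0 _ hk1.le
            apply max_le _ (exp_pos _).le
            have := Real.add_one_le_exp (-(u / k)); linarith
        _ = _ := by rw [← Real.exp_mul]; congr 1; ring
    have h2 := wg_exp_diff (u * (k - 1) / k) u
    have h3 := wg_exp_u (u * (k - 1) / k)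
    have h4 : u - u * (k - 1) / k = (u * (k - 1) / k) * (1 / (k - 1)) := by
      field_simp; ring
    rw [h4, mul_right_comm] at h2
    have h5 : (u * (k - 1) / k) * exp (-(u * (k - 1) / k)) * (1 / (k - 1)) ≤ 1 * (1 / (k - 1)) := by
      gcongr
    have h6 : 1 / (k - 1) ≤ 2 / (k - 1) := by gcongr; norm_num
    linarith

lemma wg_gamma_mid (x : ℝ) (hx : 0 < x) :
    Gamma (x + 1/2) ^ 2 ≤ Gamma x * Gamma (x + 1) := by
  have h := Real.Gamma_mul_add_mul_le_rpow_Gamma_mul_rpow_Gamma (s := x) (t := x + 1)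
    (a := 1/2) (b := 1/2) hx (by linarith) (by norm_num) (by norm_num) (by norm_num)
  rw [show 1/2 * x + 1/2 * (x+1) = x + 1/2 by ring] at h
  have p1 := Gamma_pos_of_pos hx
  have p2 := Gamma_pos_of_pos (show 0 < x + 1 by linarith)
  have p3 := Gamma_pos_of_pos (show 0 < x + 1/2 by linarith)
  rw [← Real.mul_rpow p1.le p2.le, ← Real.sqrt_eq_rpow] at h
  calc _ ≤ (√(Gamma x * Gamma (x + 1))) ^ 2 := by gcongr
    _ = _ := Real.sq_sqrt (by positivity)

/-- ρ_k -/
noncomputable def wgRho (k : ℝ) : ℝ := Gamma (k + 1) ^ 2 / (k * Gamma (k + 1/2) ^ 2)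

lemma wg_rho (k : ℝ) (hk : 0 < k) : 1 ≤ wgRho k ∧ wgRho k ≤ 1 + 1 / (2 * k) := by
  have p1 := Gamma_pos_of_pos hk
  have p3 := Gamma_pos_of_pos (show 0 < k + 1/2 by linarith)
  have h1 := wg_gamma_mid k hk
  have h2 := wg_gamma_mid (k + 1/2) (by linarith)
  rw [Real.Gamma_add_one (by linarith : k + 1/2 ≠ 0), show k + 1/2 + 1/2 = k + 1 by ring] at h2
  unfold wgRho
  constructor
  · rw [le_div_iff₀ (by positivity)]
    rw [Real.Gamma_add_one hk.ne'] at h1 ⊢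
    nlinarith
  · rw [div_le_iff₀ (by positivity)]
    calc _ ≤ _ := h2
      _ = _ := by field_simp

/-- normalising constant -/
noncomputable def wgC (l m : ℕ) : ℝ := ((m + l + 1).factorial : ℝ) / (m.factorial * l.factorial)

/-- Beta density -/
noncomputable def wgW (l m : ℕ) (s : ℝ) : ℝ := wgC l m * (s ^ m * (1 - s) ^ l)

/-- truncated power kernel -/
noncomputable def wgG (m : ℕ) (r s : ℝ) : ℝ :=
  (max (1 - r ^ 2 / s ^ 2) 0) ^ (((m : ℝ) + 1) / 2 - 1)

lemma wgW_cont (l m : ℕ) : Continuous (wgW l m) := by unfold wgW; fun_prop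

lemma wgC_pos (l m : ℕ) : 0 < wgC l m := by unfold wgC; positivity

lemma wgW_nonneg (l m : ℕ) (s : ℝ) (h0 : 0 ≤ s) (h1 : s ≤ 1) : 0 ≤ wgW l m s := by
  have := wgC_pos l m
  have : 0 ≤ 1 - s := by linarith
  unfold wgW; positivity

lemma wgW_int (l m : ℕ) : ∫ s in (0:ℝ)..1, wgW l m s = 1 := by
  unfold wgW wgC
  rw [intervalIntegral.integral_const_mul, wg_beta]
  field_simp

lemma wgW_var (l m : ℕ) : (∫ s in (0:ℝ)..1, wgW l m s *
    (((l:ℝ) + m + 2) * s / (m + 1) - 1) ^ 2) ≤ (1:ℝ) / ((m:ℝ) + 1) := by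
  have e : ∀ s : ℝ, wgW l m s * (((l:ℝ) + m + 2) * s / (m + 1) - 1) ^ 2
      = wgC l m * (((l:ℝ) + m + 2) / (m + 1)) ^ 2 * (s ^ (m + 2) * (1 - s) ^ l)
        - wgC l m * (2 * (((l:ℝ) + m + 2) / (m + 1))) * (s ^ (m + 1) * (1 - s) ^ l)
        + wgC l m * (s ^ m * (1 - s) ^ l) := by
    intro s; unfold wgW; ring
  have i : ∀ (c : ℝ) (a : ℕ), IntervalIntegrable (fun s : ℝ => c * (s ^ a * (1 - s) ^ l)) volume 0 1 :=
    fun c a => Continuous.intervalIntegrable (by fun_prop) _ _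
  simp_rw [e]
  rw [intervalIntegral.integral_add ((i _ _).sub (i _ _)) (i _ _),
    intervalIntegral.integral_sub (i _ _) (i _ _)]
  simp only [intervalIntegral.integral_const_mul, wg_beta]
  unfold wgC
  rw [show m + 2 + l + 1 = (m + l + 1) + 1 + 1 by ring, show m + 1 + l + 1 = (m + l + 1) + 1 by ring]
  simp only [Nat.factorial_succ (m + l + 1 + 1), Nat.factorial_succ (m + l + 1),
    Nat.factorial_succ (m + 1), Nat.factorial_succ m]
  have p1 : (0:ℝ) < (m + l + 1).factorial := by positivity
  have p2 : (0:ℝ) < m.factorial := by positivity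
  have p3 : (0:ℝ) < l.factorial := by positivity
  generalize ((m + l + 1).factorial : ℕ) = A at *
  generalize (m.factorial : ℕ) = B at *
  generalize (l.factorial : ℕ) = D at *
  have hm : (0:ℝ) ≤ m := by positivity
  have hl : (0:ℝ) ≤ l := by positivity
  push_cast
  generalize (m : ℝ) = m at *
  generalize (l : ℝ) = l at *
  have : (A:ℝ) / (B * D) * ((l + m + 2) / (m + 1)) ^ 2 *
        ((m + 1 + 1) * ((m + 1) * B) * D / ((m + l + 1 + 1 + 1) * ((m + l + 1 + 1) * A))) -
      A / (B * D) * (2 * ((l + m + 2) / (m + 1))) * ((m + 1) * B * D / ((m + l + 1 + 1) * A)) +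
      A / (B * D) * (B * D / A) = (l + 1) / ((m + 1) * (m + l + 3)) := by
    field_simp; ring
  rw [this, div_le_div_iff₀ (by positivity) (by positivity)]
  nlinarith [mul_nonneg hm hm]

lemma wgG_meas (m : ℕ) (r : ℝ) : Measurable (wgG m r) := by unfold wgG; fun_prop

lemma wgG_bound (m : ℕ) (hm : 3 ≤ m) (r s : ℝ) : 0 ≤ wgG m r s ∧ wgG m r s ≤ 1 := by
  have hm' : (3:ℝ) ≤ m := by exact_mod_cast hm
  unfold wgG
  have h0 : 0 ≤ max (1 - r ^ 2 / s ^ 2) 0 := le_max_right _ _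
  have h1 : max (1 - r ^ 2 / s ^ 2) 0 ≤ 1 := max_le (by
    have : 0 ≤ r ^ 2 / s ^ 2 := by positivity
    linarith) zero_le_one
  exact ⟨Real.rpow_nonneg h0 _, Real.rpow_le_one h0 h1 (by linarith)⟩

lemma wgWG_int (l m : ℕ) (hm : 3 ≤ m) (r a b : ℝ) :
    IntervalIntegrable (fun s => wgW l m s * wgG m r s) volume a b := by
  have hW : IntervalIntegrable (wgW l m) volume a b := (wgW_cont l m).intervalIntegrable _ _
  rw [intervalIntegrable_iff] at hW ⊢
  refine hW.mul_bdd (c := 1) (wgG_meas m r).aestronglyMeasurable (ae_of_all _ fun s => ?_)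
  have := wgG_bound m hm r s
  rw [Real.norm_eq_abs, abs_of_nonneg this.1]; exact this.2

lemma wgG_zero (m : ℕ) (hm : 3 ≤ m) (r s : ℝ) (hs : 0 < s) (h : s ≤ r) : wgG m r s = 0 := by
  have hm' : (3:ℝ) ≤ m := by exact_mod_cast hm
  unfold wgG
  rw [max_eq_right, Real.zero_rpow (by linarith)]
  rw [sub_nonpos, le_div_iff₀ (by positivity)]
  nlinarith

lemma wg_integrand (l m : ℕ) (r s : ℝ) (hr : 0 ≤ r) (h : r < s) :
    wgC l m * (s * (1 - s) ^ l * (s ^ 2 - r ^ 2) ^ (((m : ℝ) + 1) / 2 - 1))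
      = wgW l m s * wgG m r s := by
  have hs : 0 < s := by linarith
  unfold wgW wgG
  have h1 : 0 ≤ 1 - r ^ 2 / s ^ 2 := by
    rw [sub_nonneg, div_le_one (by positivity)]; nlinarith
  rw [max_eq_left h1]
  have h2 : s ^ 2 - r ^ 2 = s ^ 2 * (1 - r ^ 2 / s ^ 2) := by field_simp
  have h3 : s * (s ^ 2) ^ (((m : ℝ) + 1) / 2 - 1) = s ^ m := by
    rw [← Real.rpow_natCast s 2, ← Real.rpow_mul hs.le, ← Real.rpow_natCast s m]
    nth_rw 1 [← Real.rpow_one s]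
    rw [← Real.rpow_add hs]; congr 1; push_cast; ring
  rw [h2, Real.mul_rpow (by positivity) h1, ← h3]; ring

lemma wgDelta_pos (l : ℕ) (k α : ℝ) (hk : 0 < k) (hα : 0 < α) : 0 < wendlandDelta l k α := by
  have p1 := Real.Gamma_pos_of_pos (show 0 < k + 1 by linarith)
  have p3 := Real.Gamma_pos_of_pos (show 0 < k + 1/2 by linarith)
  unfold wendlandDelta
  positivity

lemma wg_psi_eq (l m : ℕ) (hm : 3 ≤ m) (α y : ℝ) (hα : 0 < α) (hy : 0 ≤ y) :
    psi l (((m : ℝ) + 1) / 2) α y =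
      ∫ s in (0:ℝ)..1, wgW l m s * wgG m (y / wendlandDelta l (((m : ℝ) + 1) / 2) α) s := by
  have hk : 0 < ((m : ℝ) + 1) / 2 := by positivity
  have hδ := wgDelta_pos l _ α hk hα
  have hC : Real.Gamma ((l : ℝ) + 2 * (((m : ℝ) + 1) / 2) + 1) /
        (Real.Gamma ((l : ℝ) + 1) * Real.Gamma (2 * (((m : ℝ) + 1) / 2))) = wgC l m := by
    rw [show (l : ℝ) + 2 * (((m : ℝ) + 1) / 2) + 1 = ((m + l + 1 : ℕ) : ℝ) + 1 by push_cast; ring,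
      show 2 * (((m : ℝ) + 1) / 2) = (m : ℝ) + 1 by ring]
    simp only [Real.Gamma_nat_eq_factorial]
    unfold wgC; rw [mul_comm (l.factorial : ℝ)]
  have hG := Real.Gamma_pos_of_pos hk
  unfold psi
  set δ := wendlandDelta l (((m : ℝ) + 1) / 2) α with hδd
  set r := y / δ with hr
  have hr0 : 0 ≤ r := by positivity
  have hint := wgWG_int l m hm r
  split_ifs with h
  · have hr1 : r ≤ 1 := by rw [hr, div_le_one hδ]; exact h
    unfold wendland
    rw [if_pos hr1, ← intervalIntegral.integral_add_adjacent_intervals (hint 0 r) (hint r 1)]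
    have z : ∫ s in (0:ℝ)..r, wgW l m s * wgG m r s = 0 := by
      apply intervalIntegral.integral_zero_ae
      refine ae_of_all _ fun s hs => ?_
      rw [Set.uIoc_of_le hr0] at hs
      rw [wgG_zero m hm r s hs.1 hs.2, mul_zero]
    have c : ∫ s in r..1, wgW l m s * wgG m r s = wgC l m *
        ∫ s in r..1, (s * (1 - s) ^ l * (s ^ 2 - r ^ 2) ^ (((m : ℝ) + 1) / 2 - 1)) := by
      rw [← intervalIntegral.integral_const_mul]
      apply intervalIntegral.integral_congr_ae
      refine ae_of_all _ fun s hs => ?_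
      rw [Set.uIoc_of_le hr1] at hs
      exact (wg_integrand l m r s hr0 hs.1).symm
    rw [z, c, zero_add, ← hC]
    have p : (0:ℝ) < 2 ^ (((m : ℝ) + 1) / 2 - 1) := by positivity
    field_simp
  · symm
    apply intervalIntegral.integral_zero_ae
    refine ae_of_all _ fun s hs => ?_
    rw [Set.uIoc_of_le zero_le_one] at hs
    have hr1 : 1 ≤ r := by rw [hr, le_div_iff₀ hδ]; linarith
    rw [wgG_zero m hm r s hs.1 (hs.2.trans hr1), mul_zero]

lemma wg_arg (l m : ℕ) (α y s : ℝ) (hα : 0 < α) (hs : 0 < s) :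
    (y / wendlandDelta l (((m : ℝ) + 1) / 2) α) ^ 2 / s ^ 2 =
      (wgRho (((m : ℝ) + 1) / 2) * (α * y ^ 2)) / (((l:ℝ) + m + 2) * s / (m + 1)) ^ 2
        / (((m : ℝ) + 1) / 2) := by
  have hk : 0 < ((m : ℝ) + 1) / 2 := by positivity
  have p1 := Real.Gamma_pos_of_pos (show 0 < ((m : ℝ) + 1) / 2 + 1 by linarith)
  have p3 := Real.Gamma_pos_of_pos (show 0 < ((m : ℝ) + 1) / 2 + 1/2 by linarith)
  unfold wendlandDelta wgRho
  rw [show (l : ℝ) + 2 * (((m : ℝ) + 1) / 2) + 1 = (l:ℝ) + m + 2 by ring]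
  generalize Real.Gamma (((m : ℝ) + 1) / 2 + 1) = A at *
  generalize Real.Gamma (((m : ℝ) + 1) / 2 + 1/2) = B at *
  have hN : 0 < (l:ℝ) + m + 2 := by positivity
  have hM : 0 < (m:ℝ) + 1 := by positivity
  generalize (l:ℝ) + m + 2 = N at *
  generalize (m:ℝ) + 1 = M at *
  have hsq : √α ^ 2 = α := Real.sq_sqrt hα.le
  have hsq0 : 0 < √α := Real.sqrt_pos.2 hα
  generalize √α = q at *
  subst hsq
  field_simp

lemma wg_main (l m : ℕ) (hm : 3 ≤ m) (α y ε : ℝ) (hα : 0 < α) (hy : 0 ≤ y) (hε : 0 < ε) :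
    |psi l (((m : ℝ) + 1) / 2) α y - Real.exp (-(α * y ^ 2))| ≤
      2 / (((m : ℝ) + 1) / 2 - 1) + 3 * ε + 3 / ε * (1 / (m + 1)) + 1 / (m + 1) := by
  have hm' : (3:ℝ) ≤ m := by exact_mod_cast hm
  have hk : 0 < ((m : ℝ) + 1) / 2 := by positivity
  obtain ⟨ρ1, ρ2⟩ := wg_rho (((m : ℝ) + 1) / 2) hk
  set ρ := wgRho (((m : ℝ) + 1) / 2) with hρ
  have hv : 0 ≤ α * y ^ 2 := by positivity
  set u := ρ * (α * y ^ 2) with hu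
  have hu0 : 0 ≤ u := by positivity
  have A : |Real.exp (-u) - Real.exp (-(α * y ^ 2))| ≤ 1 / (m + 1) := by
    have h1 : α * y ^ 2 ≤ u := by nlinarith
    have h2 : Real.exp (-u) ≤ Real.exp (-(α * y ^ 2)) := Real.exp_le_exp.2 (by linarith)
    rw [abs_of_nonpos (by linarith)]
    have h3 := wg_exp_diff (α * y ^ 2) u
    have h4 := wg_exp_u (α * y ^ 2)
    have h5 : ρ - 1 ≤ 1 / (m + 1) := by
      rw [show 2 * (((m : ℝ) + 1) / 2) = (m : ℝ) + 1 by ring] at ρ2; linarith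
    have h6 : (u - α * y ^ 2) * Real.exp (-(α * y ^ 2)) =
      (ρ - 1) * (α * y ^ 2 * Real.exp (-(α * y ^ 2))) := by rw [hu]; ring
    nlinarith
  rw [wg_psi_eq l m hm α y hα hy]
  set r := y / wendlandDelta l (((m : ℝ) + 1) / 2) α with hr
  set c1 := 2 / (((m : ℝ) + 1) / 2 - 1) + 3 * ε with hc1
  have P : ∀ s ∈ Set.Ioo (0:ℝ) 1, |wgW l m s * wgG m r s - wgW l m s * Real.exp (-u)| ≤
      c1 * wgW l m s + 3 / ε * (wgW l m s * (((l:ℝ) + m + 2) * s / (m + 1) - 1) ^ 2) := by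
    intro s hs
    have hs0 : 0 < s := hs.1
    have hw := wgW_nonneg l m s hs.1.le hs.2.le
    have hX : 0 < ((l:ℝ) + m + 2) * s / (m + 1) := by positivity
    have hg : wgG m r s = (max (1 - u / (((l:ℝ) + m + 2) * s / (m + 1)) ^ 2
        / (((m : ℝ) + 1) / 2)) 0) ^ (((m : ℝ) + 1) / 2 - 1) := by
      unfold wgG; rw [hr, wg_arg l m α y s hα hs.1]
    set X := ((l:ℝ) + m + 2) * s / (m + 1) with hXd
    have b1 := wg_pow (((m : ℝ) + 1) / 2) (u / X ^ 2) (by linarith) (by positivity)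
    rw [← hg] at b1
    have b2 := wg_lip u X hu0 hX
    have b3 : 6 * |X - 1| ≤ 3 * ε + 3 / ε * (X - 1) ^ 2 := by
      have : 3 * ε + 3 / ε * (X - 1) ^ 2 - 6 * |X - 1| = 3 / ε * (|X - 1| - ε) ^ 2 := by
        rw [← sq_abs (X - 1)]; field_simp; ring
      have : 0 ≤ 3 / ε * (|X - 1| - ε) ^ 2 := by positivity
      linarith
    have b4 := abs_sub_le (wgG m r s) (Real.exp (-(u / X ^ 2))) (Real.exp (-u))
    rw [← mul_sub, abs_mul, abs_of_nonneg hw]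
    calc _ ≤ wgW l m s * (c1 + 3 / ε * (X - 1) ^ 2) := by
          apply mul_le_mul_of_nonneg_left _ hw; linarith
      _ = _ := by ring
  have i1 := wgWG_int l m hm r 0 1
  have i2 : IntervalIntegrable (fun s => wgW l m s * Real.exp (-u)) volume 0 1 :=
    Continuous.intervalIntegrable ((wgW_cont l m).mul_const _) _ _
  have i3 : IntervalIntegrable (fun s => c1 * wgW l m s) volume 0 1 :=
    Continuous.intervalIntegrable ((wgW_cont l m).const_mul _) _ _
  have i4 : IntervalIntegrable (fun s => 3 / ε *
      (wgW l m s * (((l:ℝ) + m + 2) * s / (m + 1) - 1) ^ 2)) volume 0 1 := by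
    apply Continuous.intervalIntegrable
    have := wgW_cont l m
    fun_prop
  have Q : |(∫ s in (0:ℝ)..1, wgW l m s * wgG m r s) - Real.exp (-u)| ≤
      c1 + 3 / ε * (1 / (m + 1)) := by
    have e1 : Real.exp (-u) = ∫ s in (0:ℝ)..1, wgW l m s * Real.exp (-u) := by
      rw [intervalIntegral.integral_mul_const, wgW_int, one_mul]
    calc _ = |∫ s in (0:ℝ)..1, (wgW l m s * wgG m r s - wgW l m s * Real.exp (-u))| := by
          rw [intervalIntegral.integral_sub i1 i2, ← e1]
      _ ≤ ∫ s in (0:ℝ)..1, |wgW l m s * wgG m r s - wgW l m s * Real.exp (-u)| :=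
          intervalIntegral.abs_integral_le_integral_abs zero_le_one
      _ ≤ ∫ s in (0:ℝ)..1, (c1 * wgW l m s + 3 / ε *
            (wgW l m s * (((l:ℝ) + m + 2) * s / (m + 1) - 1) ^ 2)) :=
          intervalIntegral.integral_mono_on_of_le_Ioo zero_le_one (i1.sub i2).abs (i3.add i4) P
      _ ≤ _ := by
          rw [intervalIntegral.integral_add i3 i4, intervalIntegral.integral_const_mul,
            intervalIntegral.integral_const_mul, wgW_int, mul_one]
          have := wgW_var l m
          gcongr
  have := abs_sub_le (∫ s in (0:ℝ)..1, wgW l m s * wgG m r s) (Real.exp (-u))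
    (Real.exp (-(α * y ^ 2)))
  linarith

/-- Main theorem: the normalised equal area Wendland functions, with smoothness
k = (m+1)/2 running through integers and half-integers, converge uniformly on [0,∞)
to the Gaussian e^{-αy²} as k → ∞. -/
theorem wendland_tendsto_gaussian (d : ℕ) (hd : 0 < d) (α : ℝ) (hα : 0 < α) :
    TendstoUniformlyOn
      (fun m : ℕ => fun y : ℝ => psi (lfun d (((m : ℝ) + 1) / 2)) (((m : ℝ) + 1) / 2) α y)
      (fun y => Real.exp (-α * y ^ 2)) atTop (Set.Ici 0) := by
  rw [Metric.tendstoUniformlyOn_iff]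
  intro η hη
  have t1 : Tendsto (fun m : ℕ => (1:ℝ) / ((m : ℝ) + 1)) atTop (nhds 0) :=
    tendsto_one_div_add_atTop_nhds_zero_nat
  have hc : 0 < η / 2 / (8 + 3 / (η / 6) + 1) := by positivity
  filter_upwards [t1.eventually (gt_mem_nhds hc), eventually_ge_atTop 3] with m h1 hm y hy
  have hm' : (3:ℝ) ≤ m := by exact_mod_cast hm
  have b := wg_main (lfun d (((m : ℝ) + 1) / 2)) m hm α y (η / 6) hα hy (by positivity)
  rw [dist_comm, Real.dist_eq, neg_mul]
  refine b.trans_lt ?_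
  have h2 : 2 / (((m : ℝ) + 1) / 2 - 1) ≤ 8 * (1 / (m + 1)) := by
    rw [mul_one_div, div_le_div_iff₀ (by linarith) (by linarith)]; linarith
  rw [lt_div_iff₀ (by positivity)] at h1
  nlinarith
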